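/- Let −1 < α < 1 and let A, B be n×n Hermitian positive-definite complex matrices. Then the log-det α-divergence D_LD^α(A,B) = (4/(1−α²)) log [ det( ((1−α)/2) A + ((1+α)/2) B ) / ( (det A)^{(1−α)/2} (det B)^{(1+α)/2} ) ] is nonnegative, and it equals zero if and only if A = B. -/

import Mathlib

open scoped ComplexOrder Matrix

open scoped MatrixOrder in
/-- A pair of Hermitian positive-definite matrices can be diagonalized by a common congruence,
with the first matrix becoming the identity. -/
theorem Matrix.PosDef.exists_simultaneous_diagonalization {ι : Type*} [Fintype ι] [DecidableEq ι]
    {A B : Matrix ι ι ℂ} (hA : A.PosDef) (hB : B.PosDef) :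
    ∃ (P : Matrix ι ι ℂ) (d : ι → ℝ), (∀ i, 0 < d i) ∧ A = P * Pᴴ ∧
      B = P * Matrix.diagonal (fun i => (d i : ℂ)) * Pᴴ := by
  obtain ⟨Q, hQ⟩ := CStarAlgebra.nonneg_iff_eq_mul_star_self.mp hA.posSemidef.nonneg
  rw [Matrix.star_eq_conjTranspose] at hQ
  have hdet : IsUnit Q.det := by
    have h := hA.det_pos.ne'
    rw [hQ, Matrix.det_mul] at h
    exact (left_ne_zero_of_mul h).isUnit
  have hdet' : IsUnit Qᴴ.det := by
    rw [Matrix.det_conjTranspose]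
    exact hdet.star
  have hQinv : IsUnit Q⁻¹ :=
    (Matrix.isUnit_iff_isUnit_det _).mpr (Matrix.isUnit_nonsing_inv_det _ hdet)
  have hC : (Q⁻¹ * B * (Q⁻¹)ᴴ).PosDef :=
    (Matrix.IsUnit.posDef_star_right_conjugate_iff hQinv).mpr hB
  set C := Q⁻¹ * B * (Q⁻¹)ᴴ with hCdef
  have hspec := hC.isHermitian.spectral_theorem
  set U := hC.isHermitian.eigenvectorUnitary
  rw [Unitary.conjStarAlgAut_apply] at hspec
  refine ⟨Q * (U : Matrix ι ι ℂ), hC.isHermitian.eigenvalues, hC.eigenvalues_pos, ?_, ?_⟩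
  · have hU : (U : Matrix ι ι ℂ) * (U : Matrix ι ι ℂ)ᴴ = 1 := Unitary.coe_mul_star_self U
    rw [Matrix.conjTranspose_mul, Matrix.mul_assoc, ← Matrix.mul_assoc _ _ Qᴴ, hU, Matrix.one_mul,
      hQ]
  · have hBC : B = Q * C * Qᴴ := by
      rw [hCdef, Matrix.conjTranspose_nonsing_inv, Matrix.mul_assoc, Matrix.mul_assoc,
        Matrix.mul_assoc, Matrix.nonsing_inv_mul _ hdet', Matrix.mul_one,
        Matrix.mul_nonsing_inv_cancel_left _ _ hdet]
    rw [hBC]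
    conv_lhs => rw [hspec]
    rw [Matrix.conjTranspose_mul]
    simp only [Matrix.mul_assoc, Matrix.star_eq_conjTranspose]
    rfl

theorem Real.mul_log_lt_log_add_mul {s t x : ℝ} (hs : 0 < s) (ht : 0 < t) (hst : s + t = 1)
    (hx : 0 < x) (hx1 : x ≠ 1) : t * Real.log x < Real.log (s + t * x) := by
  have h := strictConcaveOn_log_Ioi.2 (Set.mem_Ioi.mpr one_pos) (Set.mem_Ioi.mpr hx) hx1.symm
    hs ht hst
  simpa using h

/-- The logarithm of the quotient of the determinant of a weighted mean by the weighted geometric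
mean of the determinants, for a pair of matrices diagonalized by a common congruence. -/
theorem Matrix.log_det_quotient_eq_sum {ι : Type*} [Fintype ι] [DecidableEq ι]
    (P : Matrix ι ι ℂ) (d : ι → ℝ) {s t : ℝ} (hs : 0 < s) (ht : 0 < t) (hst : s + t = 1)
    (hd : ∀ i, 0 < d i) (hP : P.det ≠ 0) :
    Real.log ((s • (P * Pᴴ) + t • (P * Matrix.diagonal (fun i => (d i : ℂ)) * Pᴴ)).det.re /
      ((P * Pᴴ).det.re ^ s * (P * Matrix.diagonal (fun i => (d i : ℂ)) * Pᴴ).det.re ^ t)) =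
      ∑ i, (Real.log (s + t * d i) - t * Real.log (d i)) := by
  have key (e : ι → ℝ) : (P * Matrix.diagonal (fun i => (e i : ℂ)) * Pᴴ).det.re =
      Complex.normSq P.det * ∏ i, e i := by
    rw [Matrix.det_mul, Matrix.det_mul, Matrix.det_diagonal, Matrix.det_conjTranspose,
      mul_right_comm, Complex.star_def, Complex.mul_conj, ← Complex.ofReal_prod,
      ← Complex.ofReal_mul, Complex.ofReal_re]
  have hmix : s • (P * Pᴴ) + t • (P * Matrix.diagonal (fun i => (d i : ℂ)) * Pᴴ) =
      P * Matrix.diagonal (fun i => ((s + t * d i : ℝ) : ℂ)) * Pᴴ := by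
    have hdiag : Matrix.diagonal (fun i => ((s + t * d i : ℝ) : ℂ)) =
        s • (1 : Matrix ι ι ℂ) + t • Matrix.diagonal (fun i => (d i : ℂ)) := by
      ext i j
      by_cases h : i = j <;> simp [h]
    rw [hdiag]
    simp [Matrix.mul_add, Matrix.add_mul]
  have hone : (P * Pᴴ).det.re = Complex.normSq P.det := by
    simpa using key (fun _ => 1)
  have hc : 0 < Complex.normSq P.det := Complex.normSq_pos.mpr hP
  have hpos (i : ι) : 0 < s + t * d i := by have := hd i; positivity
  have hprod : 0 < ∏ i, d i := Finset.prod_pos fun i _ => hd i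
  have hprod' : 0 < ∏ i, (s + t * d i) := Finset.prod_pos fun i _ => hpos i
  rw [hmix, key, key, hone, Real.log_div (by positivity) (by positivity),
    Real.log_mul hc.ne' hprod'.ne', Real.log_mul (by positivity) (by positivity),
    Real.log_rpow hc, Real.log_rpow (by positivity), Real.log_mul hc.ne' hprod.ne',
    Real.log_prod (fun i _ => (hpos i).ne'), Real.log_prod (fun i _ => (hd i).ne'),
    Finset.sum_sub_distrib, ← Finset.mul_sum]
  linear_combination (-Real.log (Complex.normSq P.det)) * hst

/-- The log-det α-divergence between Hermitian positive-definite matrices is nonnegative,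
and vanishes exactly when the two matrices are equal. -/
theorem logDet_alpha_div_nonneg_eq_zero_iff (n : ℕ) (α : ℝ) (hα : -1 < α) (hα' : α < 1)
    (A B : Matrix (Fin n) (Fin n) ℂ) (hA : A.PosDef) (hB : B.PosDef)
    (D : ℝ)
    (hD : D = (4 / (1 - α ^ 2)) *
      Real.log (((((1 - α) / 2 : ℝ) • A + (((1 + α) / 2 : ℝ)) • B).det.re) /
        (A.det.re ^ ((1 - α) / 2) * B.det.re ^ ((1 + α) / 2)))) :
    0 ≤ D ∧ (D = 0 ↔ A = B) := by
  obtain ⟨P, d, hd, rfl, rfl⟩ := hA.exists_simultaneous_diagonalization hB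
  have hP : P.det ≠ 0 := by
    have h := hA.det_pos.ne'
    rw [Matrix.det_mul] at h
    exact left_ne_zero_of_mul h
  have hs : 0 < (1 - α) / 2 := by linarith
  have ht : 0 < (1 + α) / 2 := by linarith
  have hst : (1 - α) / 2 + (1 + α) / 2 = 1 := by ring
  rw [Matrix.log_det_quotient_eq_sum P d hs ht hst hd hP] at hD
  have hfactor : 0 < 4 / (1 - α ^ 2) := div_pos (by norm_num) (by nlinarith)
  have hterm (i : Fin n) :
      0 ≤ Real.log ((1 - α) / 2 + (1 + α) / 2 * d i) - (1 + α) / 2 * Real.log (d i) := by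
    by_cases h : d i = 1
    · simp [h, hst]
    · exact sub_nonneg.mpr (Real.mul_log_lt_log_add_mul hs ht hst (hd i) h).le
  refine ⟨hD ▸ mul_nonneg hfactor.le (Finset.sum_nonneg fun i _ => hterm i), ?_, ?_⟩
  · intro h0
    rw [hD, mul_eq_zero, or_iff_right hfactor.ne',
      Finset.sum_eq_zero_iff_of_nonneg fun i _ => hterm i] at h0
    have hd1 : d = fun _ => 1 := by
      funext i
      by_contra h
      exact (sub_pos.mpr (Real.mul_log_lt_log_add_mul hs ht hst (hd i) h)).ne'
        (h0 i (Finset.mem_univ i))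
    simp [hd1]
  · intro h
    have hPu : IsUnit P.det := hP.isUnit
    have hPu' : IsUnit Pᴴ.det := by
      rw [Matrix.det_conjTranspose]
      exact hPu.star
    have h1 : Matrix.diagonal (fun i => (d i : ℂ)) = 1 := by
      have h2 := congrArg (fun M => P⁻¹ * M * (Pᴴ)⁻¹) h
      simp only [Matrix.mul_assoc, Matrix.mul_nonsing_inv _ hPu', Matrix.mul_one,
        Matrix.nonsing_inv_mul_cancel_left _ _ hPu] at h2
      exact h2.symm
    have hd1 (i : Fin n) : d i = 1 := by
      have h2 := congrFun (congrFun h1 i) i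
      simpa using h2
    simp [hD, hd1, hst]
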